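/- Let (Ω, 𝓕, P) be a probability space and f : Ω → ℝ^d a Bochner-integrable (strongly measurable and integrable) function. Then for every measurable set A ⊆ Ω with P(A) = 1, the barycenter ∫_Ω f dP belongs to convexHull ℝ (f '' A), the convex hull (not merely its closure) of the image of A under f. -/

import Mathlib

open MeasureTheory

/-- In finite dimension, a point outside a nonempty convex set is weakly separated from it by a
nonzero continuous linear functional, without any topological assumption on the set. -/
theorem Convex.exists_strongDual_ne_zero_forall_le_of_notMem {E : Type*} [NormedAddCommGroup E]
    [NormedSpace ℝ E] [FiniteDimensional ℝ E] {s : Set E} (hs : Convex ℝ s) (hne : s.Nonempty)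
    {x : E} (hx : x ∉ s) : ∃ l : StrongDual ℝ E, l ≠ 0 ∧ ∀ a ∈ s, l a ≤ l x := by
  by_cases hne_int : (interior s).Nonempty
  · exact geometric_hahn_banach_of_nonempty_interior_point hs
      (fun h ↦ hx (interior_subset h)) hne_int
  · obtain ⟨p, hp⟩ := hne
    have hlt : (affineSpan ℝ s).direction < ⊤ := by
      rw [lt_top_iff_ne_top, Ne, AffineSubspace.direction_eq_top_iff_of_nonempty
        ⟨p, subset_affineSpan ℝ s hp⟩]
      rwa [hs.interior_nonempty_iff_affineSpan_eq_top] at hne_int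
    obtain ⟨l, hl0, hl⟩ := Submodule.exists_le_ker_of_lt_top _ hlt
    have hconst : ∀ a ∈ s, l a = l p := fun a ha ↦ by
      have h := hl (AffineSubspace.vsub_mem_direction (subset_affineSpan ℝ s ha)
        (subset_affineSpan ℝ s hp))
      rwa [LinearMap.mem_ker, vsub_eq_sub, map_sub, sub_eq_zero] at h
    have hL0 : LinearMap.toContinuousLinearMap l ≠ 0 := by simpa using hl0
    rcases le_total (l p) (l x) with h | h
    · exact ⟨LinearMap.toContinuousLinearMap l, hL0, fun a ha ↦ by simpa [hconst a ha] using h⟩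
    · exact ⟨-LinearMap.toContinuousLinearMap l, neg_ne_zero.2 hL0,
        fun a ha ↦ by simpa [hconst a ha] using h⟩

/-- In finite dimension, `Convex.integral_mem` holds without assuming that the convex set is
closed. -/
theorem Convex.integral_mem_of_finiteDimensional {Ω : Type*} [MeasurableSpace Ω] {μ : Measure Ω}
    [IsProbabilityMeasure μ] {E : Type*} [NormedAddCommGroup E] [NormedSpace ℝ E]
    [FiniteDimensional ℝ E] {s : Set E} (hs : Convex ℝ s) {f : Ω → E} (hfs : ∀ᵐ ω ∂μ, f ω ∈ s)
    (hf : Integrable f μ) : ∫ ω, f ω ∂μ ∈ s := by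
  induction hn : Module.finrank ℝ E using Nat.strong_induction_on generalizing E with
  | _ n ih =>
  have : CompleteSpace E := FiniteDimensional.complete ℝ E
  by_contra hx
  set x := ∫ ω, f ω ∂μ with hxdef
  obtain ⟨ω₀, hω₀⟩ := hfs.exists
  obtain ⟨l, hl0, hl⟩ := hs.exists_strongDual_ne_zero_forall_le_of_notMem ⟨_, hω₀⟩ hx
  have hfx : Integrable (fun ω ↦ f ω - x) μ := hf.sub (integrable_const x)
  have hmean : ∫ ω, (f ω - x) ∂μ = 0 := by
    rw [integral_sub hf (integrable_const x)]; simp [hxdef]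
  have hker : ∀ᵐ ω ∂μ, f ω - x ∈ l.ker := by
    have hzero : ∫ ω, (-l) (f ω - x) ∂μ = 0 := by
      rw [(-l).integral_comp_comm hfx, hmean, map_zero]
    rw [integral_eq_zero_iff_of_nonneg_ae _ ((-l).integrable_comp hfx)] at hzero
    · filter_upwards [hzero] with ω hω
      simpa [-map_sub] using hω
    · filter_upwards [hfs] with ω hω
      simpa using hl _ hω
  obtain ⟨π, hπ⟩ := Submodule.ClosedComplemented.of_finiteDimensional_quotient l.isClosed_ker
  have hlt : Module.finrank ℝ l.ker < n := by
    refine hn ▸ Submodule.finrank_lt fun htop ↦ hl0 ?_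
    ext v
    have hv : v ∈ l.ker := htop ▸ Submodule.mem_top
    simpa using hv
  have hmem := ih _ hlt (s := {v : l.ker | x + v ∈ s})
    ((hs.translate_preimage_right x).linear_preimage l.ker.subtype)
    (f := fun ω ↦ π (f ω - x)) (by
      filter_upwards [hfs, hker] with ω hω hk
      have hπω : π (f ω - x) = ⟨f ω - x, hk⟩ := hπ ⟨_, hk⟩
      simpa [hπω, -map_sub] using hω) (π.integrable_comp hfx) rfl
  rw [π.integral_comp_comm hfx, hmean, map_zero] at hmem
  exact hx (by simpa using hmem)

/-- For a probability space `(Ω, P)` and a Bochner-integrable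
function `f : Ω → ℝ^d`, the barycenter `∫ f dP` lies in the convex hull of the image
`f '' A` of any measurable set `A` of full measure. -/
theorem integral_mem_convexHull_image_of_full_measure
    {Ω : Type*} [MeasurableSpace Ω] (P : Measure Ω) [IsProbabilityMeasure P]
    {d : ℕ} (f : Ω → EuclideanSpace ℝ (Fin d)) (hf : Integrable f P)
    (A : Set Ω) (hA : MeasurableSet A) (hPA : P A = 1) :
    (∫ ω, f ω ∂P) ∈ convexHull ℝ (f '' A) := by
  refine (convex_convexHull ℝ (f '' A)).integral_mem_of_finiteDimensional ?_ hf
  filter_upwards [(prob_compl_eq_zero_iff hA).2 hPA] with ω hω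
  exact subset_convexHull ℝ _ ⟨ω, hω, rfl⟩
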